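/- The solution set S_f = {z ∈ K : f(z,y) ≥ 0 for all y ∈ K} of the equilibrium problem is a convex subset of H. -/

import Mathlib

open scoped RealInnerProductSpace

/-- The real `limsup` of an eventually nonnegative function is nonnegative, even if the function is
unbounded. -/
theorem Real.limsup_nonneg_of_eventually {α : Type*} {l : Filter α} [l.NeBot] {u : α → ℝ}
    (hu : ∀ᶠ t in l, 0 ≤ u t) : 0 ≤ Filter.limsup u l := by
  rw [Filter.limsup_eq]
  refine Real.sInf_nonneg fun a ha => ?_
  obtain ⟨t, h0, h1⟩ := (hu.and ha).exists
  exact h0.trans h1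

/-- Minty's lemma: a solution of the dual equilibrium problem solves the equilibrium problem. -/
theorem nonneg_of_dual_nonpos {H : Type*} [AddCommGroup H] [Module ℝ H] {K : Set H}
    (hK : Convex ℝ K) {f : H → H → ℝ} (h1 : ∀ x ∈ K, f x x = 0)
    (h3 : ∀ x ∈ K, ConvexOn ℝ K (f x)) {z y : H} (hz : z ∈ K) (hy : y ∈ K)
    (h4 : Filter.limsup (fun t : ℝ => f ((1 - t) • z + t • y) y) (nhdsWithin 0 (Set.Ioi 0))
      ≤ f z y)
    (hdual : ∀ x ∈ K, f x z ≤ 0) : 0 ≤ f z y := by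
  refine (Real.limsup_nonneg_of_eventually ?_).trans h4
  filter_upwards [Ioo_mem_nhdsGT (zero_lt_one' ℝ)] with t ⟨ht0, ht1⟩
  have hs : 0 ≤ 1 - t := by linarith
  have hw : (1 - t) • z + t • y ∈ K := hK hz hy hs ht0.le (by ring)
  have hconv := (h3 _ hw).2 hz hy hs ht0.le (by ring)
  rw [h1 _ hw, smul_eq_mul, smul_eq_mul] at hconv
  have hle := mul_nonpos_of_nonneg_of_nonpos hs (hdual _ hw)
  exact nonneg_of_mul_nonneg_right (by linarith) ht0

/-- The solution set `S_f = {z ∈ K : f z y ≥ 0 for all y ∈ K}` of the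
equilibrium problem is a convex subset of `H`. -/
theorem equilibrium_solutionSet_convex
    {H : Type*} [NormedAddCommGroup H] [InnerProductSpace ℝ H] [CompleteSpace H]
    (K : Set H) (hK_ne : K.Nonempty) (hK_closed : IsClosed K) (hK_convex : Convex ℝ K)
    (f : H → H → ℝ)
    (h1 : ∀ x ∈ K, f x x = 0)
    (h2 : ∀ x ∈ K, ∀ y ∈ K, f x y + f y x ≤ 0)
    (h3lsc : ∀ x ∈ K, LowerSemicontinuousOn (f x) K)
    (h3conv : ∀ x ∈ K, ConvexOn ℝ K (f x))
    (h4 : ∀ y ∈ K, ∀ x ∈ K, ∀ w ∈ K,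
      Filter.limsup (fun t : ℝ => f ((1 - t) • x + t • w) y) (nhdsWithin 0 (Set.Ioi 0))
        ≤ f x y) :
    Convex ℝ {z ∈ K | ∀ y ∈ K, 0 ≤ f z y} := by
  rintro a ⟨ha, hfa⟩ b ⟨hb, hfb⟩ s t hs ht hst
  have hz := hK_convex ha hb hs ht hst
  refine ⟨hz, fun y hy => nonneg_of_dual_nonpos hK_convex h1 h3conv hz hy (h4 y hy _ hz y hy) ?_⟩
  intro x hx
  have hxa : f x a ≤ 0 := by linarith [h2 x hx a ha, hfa x hx]
  have hxb : f x b ≤ 0 := by linarith [h2 x hx b hb, hfb x hx]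
  exact ((h3conv x hx).convex_le 0 ⟨ha, hxa⟩ ⟨hb, hxb⟩ hs ht hst).2
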